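/- The canonical A-linear map V₀ ⊗_A W₀ → V ⊗_A W₀, induced by the inclusion V₀ ↪ V and the identity on W₀ (so that v ⊗ w ↦ v ⊗ w), is bijective, i.e. an isomorphism of A-modules. -/

import Mathlib

open scoped TensorProduct

lemma aux_add {A M : Type*} [CommRing A] [AddCommGroup M] [Module A M] (B : Ideal A)
    (hB : ∀ b₁ ∈ B, ∀ b₂ ∈ B, ∃ c ∈ B, c * b₁ = b₁ ∧ c * b₂ = b₂) (x y : M)
    (hx : ∃ c ∈ B, c • x = x) (hy : ∃ c ∈ B, c • y = y) : ∃ c ∈ B, c • (x + y) = x + y := by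
  obtain ⟨a, ha, hax⟩ := hx
  obtain ⟨b, hb, hby⟩ := hy
  obtain ⟨c, hc, h1, h2⟩ := hB a ha b hb
  refine ⟨c, hc, ?_⟩
  have e1 : c • x = x := by rw [← hax, smul_smul, h1]
  have e2 : c • y = y := by rw [← hby, smul_smul, h2]
  rw [smul_add, e1, e2]

lemma aux_unit {A M : Type*} [CommRing A] [AddCommGroup M] [Module A M] (B : Ideal A)
    (hB : ∀ b₁ ∈ B, ∀ b₂ ∈ B, ∃ c ∈ B, c * b₁ = b₁ ∧ c * b₂ = b₂) (x : M)
    (hx : x ∈ B • (⊤ : Submodule A M)) : ∃ c ∈ B, c • x = x := by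
  induction hx using Submodule.smul_induction_on' with
  | smul b hb m _ =>
    obtain ⟨c, hc, h, _⟩ := hB b hb b hb
    exact ⟨c, hc, by rw [smul_smul, h]⟩
  | add x _ y _ hx hy => exact aux_add B hB x y hx hy

/-- Let `B` be an ideal of `A` such that for any `b₁, b₂ ∈ B` there exists `c ∈ B` with
`c * b₁ = b₁` and `c * b₂ = b₂`, and let `V₀ := B • V`, `W₀ := B • W`.  Then the canonical
`A`-linear map `V₀ ⊗[A] W₀ → V ⊗[A] W₀`, induced by the inclusion `V₀ ↪ V` and the identity
on `W₀` (so `v ⊗ w ↦ v ⊗ w`), is bijective. -/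
theorem statement4 (K A V W : Type*) [Field K] [CommRing A] [Algebra K A]
    [AddCommGroup V] [Module A V] [Module K V] [IsScalarTower K A V]
    [AddCommGroup W] [Module A W] [Module K W] [IsScalarTower K A W]
    (B : Ideal A)
    (hB : ∀ b₁ ∈ B, ∀ b₂ ∈ B, ∃ c ∈ B, c * b₁ = b₁ ∧ c * b₂ = b₂) :
    Function.Bijective
      ⇑(TensorProduct.map
          (B • (⊤ : Submodule A V)).subtype
          (LinearMap.id :
            ↥(B • (⊤ : Submodule A W)) →ₗ[A] ↥(B • (⊤ : Submodule A W)))) := by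
  constructor
  · rw [injective_iff_map_eq_zero]
    intro x hx
    have hu : ∃ c ∈ B, c • x = x := by
      clear hx
      induction x using TensorProduct.induction_on with
      | zero => exact ⟨0, B.zero_mem, by simp⟩
      | tmul v w =>
        obtain ⟨c, hc, h⟩ := aux_unit B hB (v : V) v.2
        refine ⟨c, hc, ?_⟩
        rw [TensorProduct.smul_tmul']
        congr 1
        exact Subtype.ext h
      | add x y hx hy => exact aux_add B hB x y hx hy
    obtain ⟨c, hc, h⟩ := hu
    let g : V →ₗ[A] ↥(B • (⊤ : Submodule A V)) :=
      LinearMap.codRestrict _ (LinearMap.lsmul A V c)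
        (fun v => Submodule.smul_mem_smul hc Submodule.mem_top)
    have key : TensorProduct.map g (LinearMap.id :
            ↥(B • (⊤ : Submodule A W)) →ₗ[A] ↥(B • (⊤ : Submodule A W))) ∘ₗ
        TensorProduct.map (B • (⊤ : Submodule A V)).subtype LinearMap.id =
        c • LinearMap.id := by
      apply TensorProduct.ext'
      intro v w
      simp only [LinearMap.comp_apply, TensorProduct.map_tmul, LinearMap.smul_apply,
        LinearMap.id_apply]
      rw [TensorProduct.smul_tmul']
      congr 1
    have k := LinearMap.congr_fun key x
    rw [LinearMap.comp_apply, hx, map_zero, LinearMap.smul_apply, LinearMap.id_apply, h] at k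
    exact k.symm
  · intro y
    induction y using TensorProduct.induction_on with
    | zero => exact ⟨0, map_zero _⟩
    | tmul v w =>
      obtain ⟨c, hc, h⟩ := aux_unit B hB (w : W) w.2
      refine ⟨(⟨c • v, Submodule.smul_mem_smul hc Submodule.mem_top⟩ :
        ↥(B • (⊤ : Submodule A V))) ⊗ₜ[A] w, ?_⟩
      have h' : c • w = w := Subtype.ext h
      rw [TensorProduct.map_tmul]
      change (c • v) ⊗ₜ[A] w = _
      rw [TensorProduct.smul_tmul, h']
    | add x y hx hy =>
      obtain ⟨a, rfl⟩ := hx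
      obtain ⟨b, rfl⟩ := hy
      exact ⟨a + b, map_add _ _ _⟩
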